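/- Let φ₀ be a dyadic partition function. For Schwartz functions f, g : ℝ² → ℂ define, for ξ ≠ 0, B̂[f,g](ξ) := (1/2) ∫_{ℝ²} (ξ·η^⊥)(ξ·(2η−ξ)) / (‖ξ‖² (‖η‖+‖ξ−η‖) ‖ξ−η‖ ‖η‖) · f̂(ξ−η) ĝ(η) dη (the integral converges absolutely), and for j ∈ ℤ set Δ_j B[f,g](x) := (2π)^{−2} ∫_{ℝ²} e^{i x·ξ} φ̂₀(2^{−j}ξ) B̂[f,g](ξ) dξ. Then there exists a constant C > 0, depending only on φ₀, such that for all Schwartz f, g, ( Σ_{j∈ℤ} ( 2^{−j/2} ‖Δ_j B[f,g]‖_{L⁴(ℝ²)} )² )^{1/2} ≤ C ( Σ_{j∈ℤ} ( 2^{−j/2} ‖φ_j ∗ f‖_{L⁴(ℝ²)} )² )^{1/2} · ( Σ_{j∈ℤ} ( 2^{−j/2} ‖φ_j ∗ g‖_{L⁴(ℝ²)} )² )^{1/2}. -/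

import Mathlib

open MeasureTheory Complex
open scoped RealInnerProductSpace ENNReal NNReal

noncomputable section

abbrev E2 : Type := EuclideanSpace ℝ (Fin 2)

/-- Rotation by 90 degrees: `η^⊥ = (-η₂, η₁)`. -/
def perp (η : E2) : E2 := (WithLp.equiv 2 (Fin 2 → ℝ)).symm ![-η 1, η 0]

/-- The first standard basis vector `e₁ = (1,0)`. -/
def e1 : E2 := EuclideanSpace.single 0 1

/-- The unit vector `a = (1/√2, 1/√2)`. -/
def aVec : E2 := (WithLp.equiv 2 (Fin 2 → ℝ)).symm ![1 / Real.sqrt 2, 1 / Real.sqrt 2]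

/-- Fourier transform `ĥ(ξ) = ∫ e^{-i x·ξ} h(x) dx`. -/
def FT (h : E2 → ℂ) (ξ : E2) : ℂ :=
  ∫ x : E2, Complex.exp (-(Complex.I * ((⟪x, ξ⟫ : ℝ) : ℂ))) * h x

/-- A dyadic partition function: a Schwartz function `φ₀` together with its
(real-valued) Fourier transform `Φ` satisfying the standard Littlewood--Paley
conditions. -/
structure DyadicData where
  φ : SchwartzMap E2 ℂ
  Φ : E2 → ℝ
  hFT : ∀ ξ : E2, FT (fun x => φ x) ξ = ((Φ ξ : ℝ) : ℂ)
  h0 : ∀ ξ : E2, 0 ≤ Φ ξ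
  h1 : ∀ ξ : E2, Φ ξ ≤ 1
  hsupp : ∀ ξ : E2, Φ ξ ≠ 0 → 1 / 2 ≤ ‖ξ‖ ∧ ‖ξ‖ ≤ 2
  hone : ∀ ξ : E2, 7 / 8 ≤ ‖ξ‖ → ‖ξ‖ ≤ 5 / 4 → Φ ξ = 1
  hsum : ∀ ξ : E2, ξ ≠ 0 → HasSum (fun k : ℤ => Φ ((2 : ℝ) ^ (-k) • ξ)) 1

/-- `ψ̂_j(ξ) = 1 − Σ_{k ≥ j−10} φ̂₀(2^{−k}(ξ − 2^j a))`. -/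
def psiHat (D : DyadicData) (j : ℤ) (ξ : E2) : ℝ :=
  1 - ∑' k : ℕ, D.Φ ((2 : ℝ) ^ (-(j - 10 + (k : ℤ))) • (ξ - (2 : ℝ) ^ j • aVec))

/-- The symbol-side bilinear form `B̂[f,g](ξ)` of the quasi-geostrophic
nonlinearity in double-divergence form. -/
def BHat (f g : SchwartzMap E2 ℂ) (ξ : E2) : ℂ :=
  (1 / 2 : ℂ) *
    ∫ η : E2, ((⟪ξ, perp η⟫ * ⟪ξ, (2 : ℝ) • η - ξ⟫ /
        (‖ξ‖ ^ 2 * (‖η‖ + ‖ξ - η‖) * ‖ξ - η‖ * ‖η‖) : ℝ) : ℂ) *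
      FT (fun x => f x) (ξ - η) * FT (fun x => g x) η

/-- The Littlewood--Paley piece
`Δ_j B[f,g](x) = (2π)^{−2} ∫ e^{ix·ξ} φ̂₀(2^{−j}ξ) B̂[f,g](ξ) dξ`. -/
def DeltaB (D : DyadicData) (f g : SchwartzMap E2 ℂ) (j : ℤ) (x : E2) : ℂ :=
  (((2 * Real.pi) ^ 2 : ℝ) : ℂ)⁻¹ *
    ∫ ξ : E2, Complex.exp (Complex.I * ((⟪x, ξ⟫ : ℝ) : ℂ)) *
      ((D.Φ ((2 : ℝ) ^ (-j) • ξ) : ℝ) : ℂ) * BHat f g ξ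

/-- The convolution `(φ_j ∗ f)(x)` with `φ_j = 2^{2j} φ₀(2^j ·)`. -/
def convPhi (D : DyadicData) (j : ℤ) (f : E2 → ℂ) (x : E2) : ℂ :=
  ∫ y : E2, (((2 : ℝ) ^ (2 * j) : ℝ) : ℂ) * D.φ ((2 : ℝ) ^ j • y) * f (x - y)

section

open scoped FourierTransform SchwartzMap ContDiff

/-- The `L²` norm of a nonnegative function. -/
def lTwo {α : Type*} [MeasurableSpace α] (μ : Measure α) (f : α → ℝ≥0∞) : ℝ≥0∞ :=
  (∫⁻ x, f x ^ 2 ∂μ) ^ (1 / 2 : ℝ)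

section LTwo

variable {α β : Type*} [MeasurableSpace α] [MeasurableSpace β] {μ : Measure α} {ν : Measure β}

lemma ENNReal.rpow_half_sq (a : ℝ≥0∞) : (a ^ (1 / 2 : ℝ)) ^ 2 = a := by
  rw [← ENNReal.rpow_natCast, ← ENNReal.rpow_mul]; norm_num

lemma ENNReal.sq_rpow_half (a : ℝ≥0∞) : (a ^ 2) ^ (1 / 2 : ℝ) = a := by
  rw [← ENNReal.rpow_natCast, ← ENNReal.rpow_mul]; norm_num

lemma lTwo_sq (f : α → ℝ≥0∞) : lTwo μ f ^ 2 = ∫⁻ x, f x ^ 2 ∂μ :=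
  ENNReal.rpow_half_sq _

lemma eLpNorm_two_eq_lTwo {F : Type*} [NormedAddCommGroup F] (f : α → F) :
    eLpNorm f 2 μ = lTwo μ (fun x => ‖f x‖ₑ) := by
  rw [eLpNorm_eq_lintegral_rpow_enorm_toReal (by norm_num) (by norm_num), lTwo]
  simp

lemma lTwo_mono {f g : α → ℝ≥0∞} (h : ∀ᵐ x ∂μ, f x ≤ g x) : lTwo μ f ≤ lTwo μ g := by
  unfold lTwo
  gcongr ?_ ^ _
  exact lintegral_mono_ae (h.mono fun x hx => by gcongr)

lemma lTwo_const_mul {f : α → ℝ≥0∞} (c : ℝ≥0∞) (hf : Measurable f) :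
    lTwo μ (fun x => c * f x) = c * lTwo μ f := by
  unfold lTwo
  simp_rw [mul_pow]
  rw [lintegral_const_mul _ (by fun_prop), ENNReal.mul_rpow_of_nonneg _ _ (by norm_num),
    ENNReal.sq_rpow_half]

lemma lintegral_mul_le_lTwo {f g : α → ℝ≥0∞} (hf : Measurable f) (hg : Measurable g) :
    ∫⁻ x, f x * g x ∂μ ≤ lTwo μ f * lTwo μ g := by
  have := ENNReal.lintegral_mul_le_Lp_mul_Lq μ Real.HolderConjugate.two_two
    hf.aemeasurable hg.aemeasurable
  simpa [lTwo] using this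

/-- Minkowski's integral inequality in `L²`. -/
lemma lTwo_lintegral_le [SFinite μ] [SFinite ν] {f : β → α → ℝ≥0∞}
    (hf : Measurable (Function.uncurry f)) :
    lTwo μ (fun x => ∫⁻ w, f w x ∂ν) ≤ ∫⁻ w, lTwo μ (f w) ∂ν := by
  have hx : ∀ x, Measurable fun w => f w x := fun x => hf.comp measurable_prodMk_right
  have hw : ∀ w, Measurable (f w) := fun w => hf.comp measurable_prodMk_left
  have hN : Measurable fun w => lTwo μ (f w) := by
    unfold lTwo
    have : Measurable fun w => ∫⁻ x, f w x ^ 2 ∂μ :=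
      Measurable.lintegral_prod_right' (f := fun p : β × α => f p.1 p.2 ^ 2) (hf.pow_const 2)
    exact this.pow_const _
  have key : ∫⁻ x, (∫⁻ w, f w x ∂ν) ^ 2 ∂μ ≤ (∫⁻ w, lTwo μ (f w) ∂ν) ^ 2 := by
    calc ∫⁻ x, (∫⁻ w, f w x ∂ν) ^ 2 ∂μ
        = ∫⁻ x, ∫⁻ w, ∫⁻ v, f w x * f v x ∂ν ∂ν ∂μ := by
          congr with x
          rw [sq, ← lintegral_mul_const _ (hx x)]
          congr with w
          rw [lintegral_const_mul _ (hx x)]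
      _ = ∫⁻ w, ∫⁻ x, ∫⁻ v, f w x * f v x ∂ν ∂μ ∂ν := by
          refine lintegral_lintegral_swap (f := fun x w => ∫⁻ v, f w x * f v x ∂ν) ?_
          refine (Measurable.lintegral_prod_right'
            (f := fun p : (α × β) × β => f p.1.2 p.1.1 * f p.2 p.1.1) ?_).aemeasurable
          exact (hf.comp (by fun_prop : Measurable fun p : (α × β) × β => (p.1.2, p.1.1))).mul
            (hf.comp (by fun_prop : Measurable fun p : (α × β) × β => (p.2, p.1.1)))
      _ = ∫⁻ w, ∫⁻ v, ∫⁻ x, f w x * f v x ∂μ ∂ν ∂ν := by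
          congr with w
          refine lintegral_lintegral_swap (f := fun x v => f w x * f v x) ?_
          exact (((hw w).comp measurable_fst).mul
            (hf.comp (by fun_prop : Measurable fun p : α × β => (p.2, p.1)))).aemeasurable
      _ ≤ ∫⁻ w, ∫⁻ v, lTwo μ (f w) * lTwo μ (f v) ∂ν ∂ν := by
          gcongr with w v
          exact lintegral_mul_le_lTwo (hw w) (hw v)
      _ = (∫⁻ w, lTwo μ (f w) ∂ν) ^ 2 := by
          simp_rw [lintegral_const_mul _ hN]
          rw [lintegral_mul_const _ hN, sq]
  calc _ ≤ ((∫⁻ w, lTwo μ (f w) ∂ν) ^ 2) ^ (1 / 2 : ℝ) := by unfold lTwo at *; gcongr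
    _ = _ := ENNReal.sq_rpow_half _

lemma lTwo_tsum_le [SFinite μ] {ι : Type*} [Countable ι] {f : ι → α → ℝ≥0∞}
    (hf : ∀ i, Measurable (f i)) :
    lTwo μ (fun x => ∑' i, f i x) ≤ ∑' i, lTwo μ (f i) := by
  let _ : MeasurableSpace ι := ⊤
  have := lTwo_lintegral_le (μ := μ) (ν := Measure.count) (f := f)
    (measurable_from_prod_countable_right hf)
  simpa [lintegral_count] using this

lemma tsum_mul_le_sq {ι : Type*} [Countable ι] (a b : ι → ℝ≥0∞) :
    ∑' i, a i * b i ≤ (∑' i, a i ^ 2) ^ (1 / 2 : ℝ) * (∑' i, b i ^ 2) ^ (1 / 2 : ℝ) := by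
  let _ : MeasurableSpace ι := ⊤
  have := lintegral_mul_le_lTwo (μ := Measure.count) (f := a) (g := b)
    (measurable_of_countable _) (measurable_of_countable _)
  simpa [lintegral_count, lTwo] using this

/-- Schur's test on `ℤ` for a convolution kernel. -/
lemma tsum_kernel_mul_le (w a b : ℤ → ℝ≥0∞) :
    ∑' p : ℤ × ℤ, w (p.2 - p.1) * (a p.1 * b p.2) ≤
      (∑' r, w r) * ((∑' i, a i ^ 2) ^ (1 / 2 : ℝ) * (∑' i, b i ^ 2) ^ (1 / 2 : ℝ)) := by
  calc ∑' p : ℤ × ℤ, w (p.2 - p.1) * (a p.1 * b p.2)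
      = ∑' k : ℤ, ∑' r : ℤ, w r * (a k * b (k + r)) := by
        rw [ENNReal.tsum_prod']
        congr with k
        rw [← (Equiv.addLeft k).tsum_eq]
        simp
    _ = ∑' r : ℤ, w r * ∑' k : ℤ, a k * b (k + r) := by
        rw [ENNReal.tsum_comm]
        simp_rw [ENNReal.tsum_mul_left]
    _ ≤ ∑' r : ℤ, w r *
          ((∑' i, a i ^ 2) ^ (1 / 2 : ℝ) * (∑' i, b i ^ 2) ^ (1 / 2 : ℝ)) := by
        gcongr with r
        refine (tsum_mul_le_sq _ _).trans_eq ?_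
        congr 2
        exact (Equiv.addRight r).tsum_eq (fun i => b i ^ 2)
    _ = _ := ENNReal.tsum_mul_right
end LTwo

lemma finrank_E2 : Module.finrank ℝ E2 = 2 := by simp

lemma lintegral_comp_smul_E2 (f : E2 → ℝ≥0∞) {R : ℝ} (hR : R ≠ 0) :
    ∫⁻ x, f (R • x) = ENNReal.ofReal ((R ^ 2)⁻¹) * ∫⁻ x, f x := by
  calc ∫⁻ x, f (R • x) = ∫⁻ y, f y ∂Measure.map (fun x => R • x) (volume : Measure E2) :=
        (lintegral_map_equiv f
          (Homeomorph.smul (isUnit_iff_ne_zero.2 hR).unit).toMeasurableEquiv).symm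
    _ = _ := by
        rw [Measure.map_addHaar_smul _ hR, lintegral_smul_measure, finrank_E2,
          abs_of_nonneg (by positivity), smul_eq_mul]

lemma integral_comp_smul_E2 (f : E2 → ℂ) (R : ℝ) :
    ∫ x, f (R • x) = ((R ^ 2)⁻¹ : ℝ) • ∫ x, f x := by
  rw [Measure.integral_comp_smul, finrank_E2, abs_of_nonneg (by positivity)]

lemma FT_eq_fourier (h : E2 → ℂ) (ξ : E2) : FT h ξ = 𝓕 h ((2 * Real.pi)⁻¹ • ξ) := by
  rw [Real.fourier_eq']
  unfold FT
  congr with x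
  rw [inner_smul_right, smul_eq_mul]
  congr 2
  have : (Real.pi : ℂ) ≠ 0 := by exact_mod_cast Real.pi_ne_zero
  push_cast
  field_simp

lemma FT_continuous (f : 𝓢(E2, ℂ)) : Continuous (FT fun x => f x) := by
  have : (FT fun x => f x) = fun ξ => (𝓕 f) ((2 * Real.pi)⁻¹ • ξ) := by
    ext ξ; rw [FT_eq_fourier]; rfl
  rw [this]
  fun_prop

lemma FT_integrable (f : 𝓢(E2, ℂ)) : Integrable (FT fun x => f x) := by
  have : (FT fun x => f x) = fun ξ => (𝓕 f) ((2 * Real.pi)⁻¹ • ξ) := by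
    ext ξ; rw [FT_eq_fourier]; rfl
  rw [this]
  exact (𝓕 f).integrable.comp_smul (by positivity)

lemma FT_bounded (f : 𝓢(E2, ℂ)) : ∃ C, ∀ ξ, ‖FT (fun x => f x) ξ‖ ≤ C := by
  refine ⟨∫ x, ‖f x‖, fun ξ => (norm_integral_le_integral_norm _).trans_eq ?_⟩
  congr with x
  rw [norm_mul, Complex.norm_exp]
  simp

/-- Plancherel's theorem for the integral Fourier transform on `L¹ ∩ L²`. -/
lemma eLpNorm_fourier_eq {H : E2 → ℂ} (h1 : Integrable H) (h2 : MemLp H 2) :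
    eLpNorm (𝓕 H) 2 = eLpNorm H 2 := by
  have hcont : Continuous (𝓕 H) := by
    exact VectorFourier.fourierIntegral_continuous Real.continuous_fourierChar
      (by exact continuous_inner) h1
  let L : Lp (α := E2) ℂ 2 := h2.toLp H
  let M : Lp (α := E2) ℂ 2 := 𝓕 L
  have hae : M =ᵐ[volume] 𝓕 H := by
    refine ae_eq_of_integral_contDiff_smul_eq
      ((Lp.memLp M).locallyIntegrable (by norm_num))
      hcont.locallyIntegrable fun g hg hgc => ?_
    have hg₁ : HasCompactSupport (Complex.ofRealCLM ∘ g) := hgc.comp_left rfl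
    have hg₂ : ContDiff ℝ ∞ (Complex.ofRealCLM ∘ g) := by fun_prop
    set G : 𝓢(E2, ℂ) := hg₁.toSchwartzMap hg₂ with hG
    have e1 : ∫ x, g x • M x
        = Lp.toTemperedDistribution M G := by
      rw [Lp.toTemperedDistribution_apply]
      simp [hG]
    have e2 : ∫ x, g x • 𝓕 H x = ∫ x, 𝓕 H x * G x := by
      congr with x
      simp [hG, mul_comm]
    have e3 : Lp.toTemperedDistribution M = 𝓕 (Lp.toTemperedDistribution L) :=
      (Lp.fourier_toTemperedDistribution_eq L).symm
    rw [e1, e2, e3, TemperedDistribution.fourier_apply,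
      Lp.toTemperedDistribution_apply]
    have := VectorFourier.integral_fourierIntegral_smul_eq_flip (L := innerₗ E2)
      (μ := volume) (ν := volume) Real.continuous_fourierChar continuous_inner h1 G.integrable
    rw [flip_innerₗ] at this
    refine Eq.trans ?_ this.symm
    refine integral_congr_ae ?_
    filter_upwards [h2.coeFn_toLp] with x hx
    rw [hx, smul_eq_mul, smul_eq_mul, mul_comm]
    rfl
  rw [← eLpNorm_congr_ae hae, ← Lp.enorm_def, ← eLpNorm_congr_ae h2.coeFn_toLp, ← Lp.enorm_def,
    ← ofReal_norm, ← ofReal_norm, Lp.norm_fourier_eq]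

lemma eLpNorm_comp_smul_E2 {R : ℝ} (hR : 0 < R) (f : E2 → ℂ) :
    eLpNorm (fun x => f (R⁻¹ • x)) 2 volume = ENNReal.ofReal R * eLpNorm f 2 volume := by
  rw [eLpNorm_two_eq_lTwo, eLpNorm_two_eq_lTwo, lTwo, lTwo,
    lintegral_comp_smul_E2 (fun x => ‖f x‖ₑ ^ 2) (by positivity),
    ENNReal.mul_rpow_of_nonneg _ _ (by norm_num), inv_pow, inv_inv,
    ENNReal.ofReal_pow hR.le, ENNReal.sq_rpow_half]

/-- A Bernstein-type inequality: `L⁴` norm of an inverse Fourier integral. -/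
lemma eLpNorm_four_le {H : E2 → ℂ} (h1 : Integrable H) (h2 : MemLp H 2) :
    eLpNorm (fun x : E2 => ∫ ξ : E2, exp (I * ((⟪x, ξ⟫ : ℝ) : ℂ)) * H ξ) 4 volume ≤
      ((∫⁻ ξ, ‖H ξ‖ₑ) * (ENNReal.ofReal (2 * Real.pi) * eLpNorm H 2 volume)) ^ (1 / 2 : ℝ) := by
  set u := fun x : E2 => ∫ ξ : E2, exp (I * ((⟪x, ξ⟫ : ℝ) : ℂ)) * H ξ with hu
  have hb : ∀ x, ‖u x‖ₑ ≤ ∫⁻ ξ, ‖H ξ‖ₑ := by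
    intro x
    refine (enorm_integral_le_lintegral_enorm _).trans_eq ?_
    congr with ξ
    rw [enorm_mul, ← ofReal_norm, Complex.norm_exp]
    simp
  have hF : u = fun x => (fun y => 𝓕 H (-y)) ((2 * Real.pi)⁻¹ • x) := by
    ext x
    simp only [hu]
    rw [← smul_neg, ← FT_eq_fourier, FT]
    congr with ξ
    rw [inner_neg_right, real_inner_comm]
    push_cast
    ring_nf
  have h2' : eLpNorm u 2 volume = ENNReal.ofReal (2 * Real.pi) * eLpNorm H 2 volume := by
    rw [hF, eLpNorm_comp_smul_E2 (by positivity) (fun y => 𝓕 H (-y)), ← eLpNorm_fourier_eq h1 h2]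
    congr 1
    rw [eLpNorm_two_eq_lTwo, eLpNorm_two_eq_lTwo, lTwo, lTwo]
    congr 1
    exact lintegral_neg_eq_self (fun x => ‖𝓕 H x‖ₑ ^ 2) 
  rw [← h2', eLpNorm_two_eq_lTwo,
    eLpNorm_eq_lintegral_rpow_enorm_toReal (by norm_num) (by norm_num)]
  set A := ∫⁻ ξ, ‖H ξ‖ₑ
  have hA : A ≠ ⊤ := h1.2.ne
  calc (∫⁻ x, ‖u x‖ₑ ^ (4 : ℝ≥0∞).toReal) ^ (1 / (4 : ℝ≥0∞).toReal)
      ≤ (∫⁻ x, A ^ 2 * ‖u x‖ₑ ^ 2) ^ (1 / 4 : ℝ) := by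
        simp only [ENNReal.toReal_ofNat]
        gcongr with x
        calc ‖u x‖ₑ ^ (4 : ℝ) = ‖u x‖ₑ ^ 2 * ‖u x‖ₑ ^ 2 := by
              rw [← pow_add]; norm_cast
          _ ≤ _ := by gcongr; exact hb x
    _ = _ := by
        rw [lintegral_const_mul' _ _ (by finiteness), ← lTwo_sq, ← mul_pow,
          ← ENNReal.rpow_natCast, ← ENNReal.rpow_mul]
        norm_num

lemma FT_compSubConst (u : 𝓢(E2, ℂ)) (c ζ : E2) :
    FT (fun x => u.compSubConstCLM ℂ (-c) x) ζ =
      exp (I * ((⟪c, ζ⟫ : ℝ) : ℂ)) * FT (fun x => u x) ζ := by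
  unfold FT
  rw [← integral_const_mul, ← integral_sub_right_eq_self _ c]
  refine integral_congr_ae (.of_forall fun x => ?_)
  simp only [SchwartzMap.compSubConstCLM_apply, sub_neg_eq_add, sub_add_cancel]
  rw [← mul_assoc, ← exp_add, inner_sub_left]
  congr 2
  push_cast
  ring

lemma eLpNorm_compSubConst (u : 𝓢(E2, ℂ)) (c : E2) (p : ℝ≥0∞) :
    eLpNorm (u.compSubConstCLM ℂ c) p volume = eLpNorm u p volume :=
  eLpNorm_comp_measurePreserving (p := p) (f := fun x => x - c) u.continuous.aestronglyMeasurable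
    (measurePreserving_sub_right volume c)

lemma fourier_conv_fourier (p q : 𝓢(E2, ℂ)) (x : E2) :
    ∫ y, 𝓕 p (x - y) * 𝓕 q y =
      𝓕 (SchwartzMap.pairing (ContinuousLinearMap.mul ℂ ℂ) q p) x := by
  have h := SchwartzMap.convolution_apply (ContinuousLinearMap.mul ℂ ℂ) (𝓕 q) (𝓕 p) x
  have hpp : ∀ (r : 𝓢(E2, ℂ)) y, 𝓕 (𝓕 r) y = r (-y) := by
    intro r y
    have : 𝓕⁻ (𝓕 r) (-y) = 𝓕 (𝓕 r) y := by
      rw [SchwartzMap.fourierInv_coe, Real.fourierInv_eq_fourier_neg, neg_neg]; rfl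
    rw [← this, FourierTransform.fourierInv_fourier_eq]
  rw [MeasureTheory.convolution_mul] at h
  simp_rw [mul_comm (𝓕 p _)]
  rw [← h]
  have h2 : SchwartzMap.convolution (ContinuousLinearMap.mul ℂ ℂ) (𝓕 q) (𝓕 p) =
    𝓕⁻ (SchwartzMap.pairing (ContinuousLinearMap.mul ℂ ℂ) (𝓕 (𝓕 q)) (𝓕 (𝓕 p))) := rfl
  rw [h2, SchwartzMap.fourierInv_coe, Real.fourierInv_eq_fourier_comp_neg]
  rw [SchwartzMap.fourier_coe]
  refine congrArg (fun F : E2 → ℂ => 𝓕 F x) (funext fun y => ?_)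
  simp [hpp]

lemma eLpNorm_conv_FT_le (p q : 𝓢(E2, ℂ)) :
    eLpNorm (fun ξ => ∫ η, FT (fun x => p x) (ξ - η) * FT (fun x => q x) η) 2 volume ≤
      ENNReal.ofReal (2 * Real.pi) ^ 3 * (eLpNorm p 4 volume * eLpNorm q 4 volume) := by
  set pq := SchwartzMap.pairing (ContinuousLinearMap.mul ℂ ℂ) q p with hpq
  have e : (fun ξ => ∫ η, FT (fun x => p x) (ξ - η) * FT (fun x => q x) η) =
      fun ξ => (((2 * Real.pi) ^ 2 : ℝ) : ℂ) • (𝓕 pq) ((2 * Real.pi)⁻¹ • ξ) := by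
    ext ξ
    rw [hpq, ← fourier_conv_fourier]
    have := integral_comp_smul_E2 (fun y => 𝓕 p ((2 * Real.pi)⁻¹ • ξ - y) * 𝓕 q y)
      (2 * Real.pi)⁻¹
    have h2 : ∫ y, 𝓕 p ((2 * Real.pi)⁻¹ • ξ - (2 * Real.pi)⁻¹ • y) *
        𝓕 q ((2 * Real.pi)⁻¹ • y) = ∫ η, FT (fun x => p x) (ξ - η) * FT (fun x => q x) η := by
      congr with η
      rw [FT_eq_fourier, FT_eq_fourier, smul_sub]; rfl
    rw [← h2, this, inv_pow, inv_inv, Complex.coe_smul]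
  have hH : eLpNorm pq 2 volume ≤ eLpNorm p 4 volume * eLpNorm q 4 volume := by
    have : (pq : E2 → ℂ) = (p : E2 → ℂ) • (q : E2 → ℂ) := by
      ext x; simp [hpq, mul_comm]
    rw [this]
    have : ENNReal.HolderTriple 4 4 2 := ⟨by
      rw [← two_mul, show (4 : ℝ≥0∞) = 2 * 2 by norm_num, ENNReal.mul_inv (by simp) (by simp),
        ← mul_assoc, ENNReal.mul_inv_cancel (by simp) (by simp), one_mul]⟩
    exact eLpNorm_smul_le_mul_eLpNorm q.continuous.aestronglyMeasurable
      p.continuous.aestronglyMeasurable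
  rw [e]
  have := eLpNorm_const_smul (((2 * Real.pi) ^ 2 : ℝ) : ℂ)
    (fun ξ => (𝓕 pq) ((2 * Real.pi)⁻¹ • ξ)) 2 (volume : Measure E2)
  refine (le_of_eq this).trans ?_
  rw [eLpNorm_comp_smul_E2 (by positivity), SchwartzMap.fourier_coe,
    eLpNorm_fourier_eq pq.integrable (pq.memLp 2 volume), ← ofReal_norm]
  rw [Complex.norm_of_nonneg (by positivity), ENNReal.ofReal_pow (by positivity), ← mul_assoc,
    ← pow_succ]
  gcongr

/-- Boundedness `L⁴ × L⁴ → L²` (on the Fourier side) of a bilinear multiplier whose symbol is the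
Fourier transform of an integrable function. -/
lemma bilinear_multiplier_le {W : Type*} [MeasureSpace W] [SFinite (volume : Measure W)]
    {K : W → ℂ} (hK : Integrable K) (hKm : Measurable K) {a b : W → E2} (ha : Measurable a)
    (hb : Measurable b) {σ : E2 → E2 → ℂ}
    (hσ : ∀ ζ η, σ ζ η = ∫ w, K w * (exp (I * ((⟪a w, ζ⟫ : ℝ) : ℂ)) *
      exp (I * ((⟪b w, η⟫ : ℝ) : ℂ))))
    (s t : ℝ) (u v : 𝓢(E2, ℂ)) :
    eLpNorm (fun ξ => ∫ η, σ (s • (ξ - η)) (t • η) *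
        (FT (fun x => u x) (ξ - η) * FT (fun x => v x) η)) 2 volume ≤
      (∫⁻ w, ‖K w‖ₑ) * (ENNReal.ofReal (2 * Real.pi) ^ 3 *
        (eLpNorm u 4 volume * eLpNorm v 4 volume)) := by
  set uw : W → 𝓢(E2, ℂ) := fun w => u.compSubConstCLM ℂ (-(s • a w)) with huw
  set vw : W → 𝓢(E2, ℂ) := fun w => v.compSubConstCLM ℂ (-(t • b w)) with hvw
  set J : W → E2 → ℂ := fun w ξ =>
    ∫ η, FT (fun x => uw w x) (ξ - η) * FT (fun x => vw w x) η with hJ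
  have hFu := FT_continuous u
  have hFv := FT_continuous v
  have hJm : Measurable (Function.uncurry J) := by
    have : StronglyMeasurable (fun p : W × E2 => ∫ η,
        (exp (I * ((⟪s • a p.1, p.2 - η⟫ : ℝ) : ℂ)) * FT (fun x => u x) (p.2 - η)) *
        (exp (I * ((⟪t • b p.1, η⟫ : ℝ) : ℂ)) * FT (fun x => v x) η)) := by
      refine StronglyMeasurable.integral_prod_right' (f := fun q : (W × E2) × E2 =>
        (exp (I * ((⟪s • a q.1.1, q.1.2 - q.2⟫ : ℝ) : ℂ)) * FT (fun x => u x) (q.1.2 - q.2)) *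
        (exp (I * ((⟪t • b q.1.1, q.2⟫ : ℝ) : ℂ)) * FT (fun x => v x) q.2)) ?_
      refine Measurable.stronglyMeasurable ?_
      have := hFu.measurable
      have := hFv.measurable
      fun_prop
    convert this.measurable using 1
    ext ⟨w, ξ⟩
    simp only [hJ, huw, hvw, FT_compSubConst, Function.uncurry_apply_pair]
  have hH : ∀ ξ, ∫ η, σ (s • (ξ - η)) (t • η) *
        (FT (fun x => u x) (ξ - η) * FT (fun x => v x) η) = ∫ w, K w * J w ξ := by
    intro ξ
    have hint : Integrable (Function.uncurry fun (η : E2) (w : W) =>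
        K w * (exp (I * ((⟪a w, s • (ξ - η)⟫ : ℝ) : ℂ)) * exp (I * ((⟪b w, t • η⟫ : ℝ) : ℂ))) *
        (FT (fun x => u x) (ξ - η) * FT (fun x => v x) η)) (volume.prod volume) := by
      obtain ⟨C, hC⟩ := FT_bounded u
      have h1 : Integrable fun p : E2 × W => C * (‖FT (fun x => v x) p.1‖ * ‖K p.2‖) :=
        ((FT_integrable v).norm.mul_prod hK.norm).const_mul C
      refine h1.mono ?_ (.of_forall fun p => ?_)
      · refine (Measurable.stronglyMeasurable ?_).aestronglyMeasurable
        have := hFu.measurable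
        have := hFv.measurable
        simp only [Function.uncurry_def]
        fun_prop
      · simp only [Function.uncurry_def, norm_mul, Complex.norm_exp]
        simp
        have := hC (ξ - p.1)
        have : ‖FT (fun x => u x) (ξ - p.1)‖ ≤ |C| := this.trans (le_abs_self _)
        nlinarith [mul_le_mul_of_nonneg_left this
          (mul_nonneg (norm_nonneg (K p.2)) (norm_nonneg (FT (fun x => v x) p.1)))]
    calc _ = ∫ η, ∫ w, K w * (exp (I * ((⟪a w, s • (ξ - η)⟫ : ℝ) : ℂ)) *
          exp (I * ((⟪b w, t • η⟫ : ℝ) : ℂ))) *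
          (FT (fun x => u x) (ξ - η) * FT (fun x => v x) η) := by
          congr with η
          rw [hσ, integral_mul_const]
      _ = ∫ w, ∫ η, K w * (exp (I * ((⟪a w, s • (ξ - η)⟫ : ℝ) : ℂ)) *
          exp (I * ((⟪b w, t • η⟫ : ℝ) : ℂ))) *
          (FT (fun x => u x) (ξ - η) * FT (fun x => v x) η) := integral_integral_swap hint
      _ = _ := by
          congr with w
          rw [hJ, ← integral_const_mul]
          congr with η
          simp only [huw, hvw, FT_compSubConst, inner_smul_left, inner_smul_right]
          simp
          ring
  have hm : ∀ w, Measurable (J w) := fun w => hJm.of_uncurry_left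
  have hJle : ∀ w, lTwo volume (fun ξ => ‖J w ξ‖ₑ) ≤ ENNReal.ofReal (2 * Real.pi) ^ 3 *
      (eLpNorm u 4 volume * eLpNorm v 4 volume) := by
    intro w
    rw [← eLpNorm_two_eq_lTwo]
    refine (eLpNorm_conv_FT_le (uw w) (vw w)).trans_eq ?_
    simp only [huw, hvw, eLpNorm_compSubConst]
  simp_rw [hH]
  rw [eLpNorm_two_eq_lTwo]
  clear_value J
  calc lTwo volume (fun ξ => ‖∫ w, K w * J w ξ‖ₑ)
      ≤ lTwo volume (fun ξ => ∫⁻ w, ‖K w‖ₑ * ‖J w ξ‖ₑ) := by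
        refine lTwo_mono (.of_forall fun ξ => ?_)
        refine (enorm_integral_le_lintegral_enorm _).trans_eq ?_
        simp_rw [enorm_mul]
    _ ≤ ∫⁻ w, lTwo volume (fun ξ => ‖K w‖ₑ * ‖J w ξ‖ₑ) := by
        refine lTwo_lintegral_le ?_
        simp only [Function.uncurry_def] at hJm ⊢
        fun_prop
    _ ≤ ∫⁻ w, ‖K w‖ₑ * (ENNReal.ofReal (2 * Real.pi) ^ 3 *
        (eLpNorm u 4 volume * eLpNorm v 4 volume)) := by
        gcongr with w
        rw [lTwo_const_mul _ (hm w).enorm]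
        gcongr
        exact hJle w
    _ = _ := by rw [lintegral_mul_const _ hKm.enorm]

/-- A smooth compactly supported symbol on `ℝ² × ℝ²` defines a bilinear multiplier that is bounded
`L⁴ × L⁴ → L²`, uniformly in the dilations of the two frequency variables. -/
lemma exists_multiplier_le_of_hasCompactSupport {σ : E2 × E2 → ℂ} (hσ : ContDiff ℝ ∞ σ)
    (hc : HasCompactSupport σ) :
    ∃ C : ℝ≥0, ∀ (s t : ℝ) (u v : 𝓢(E2, ℂ)),
      eLpNorm (fun ξ => ∫ η, σ (s • (ξ - η), t • η) *
        (FT (fun x => u x) (ξ - η) * FT (fun x => v x) η)) 2 volume ≤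
      C * (eLpNorm u 4 volume * eLpNorm v 4 volume) := by
  let e := WithLp.prodContinuousLinearEquiv 2 ℝ E2 E2
  have hc' : HasCompactSupport (σ ∘ e) := hc.comp_homeomorph e.toHomeomorph
  let S : 𝓢(WithLp 2 (E2 × E2), ℂ) := hc'.toSchwartzMap (hσ.comp e.contDiff)
  have hS : ∀ w, S w = σ (e w) := fun w => rfl
  have hrep : ∀ ζ η, σ (ζ, η) = ∫ w, (𝓕 S) w *
      (exp (I * ((⟪(2 * Real.pi) • w.fst, ζ⟫ : ℝ) : ℂ)) *
        exp (I * ((⟪(2 * Real.pi) • w.snd, η⟫ : ℝ) : ℂ))) := by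
    intro ζ η
    have h1 : σ (ζ, η) = S (e.symm (ζ, η)) := by rw [hS, e.apply_symm_apply]
    have h2 : S (e.symm (ζ, η)) = 𝓕⁻ (𝓕 S) (e.symm (ζ, η)) := by
      rw [FourierTransform.fourierInv_fourier_eq]
    rw [h1, h2, SchwartzMap.fourierInv_coe, Real.fourierInv_eq']
    congr with w
    rw [smul_eq_mul, mul_comm, ← exp_add, WithLp.prod_inner_apply, inner_smul_left,
      inner_smul_left]
    congr 2
    have he : e.symm (ζ, η) = WithLp.toLp 2 (ζ, η) := rfl
    rw [he]
    simp
    ring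
  refine ⟨((∫⁻ w, ‖(𝓕 S) w‖ₑ) * ENNReal.ofReal (2 * Real.pi) ^ 3).toNNReal, fun s t u v => ?_⟩
  rw [ENNReal.coe_toNNReal]
  · rw [mul_assoc]
    refine bilinear_multiplier_le (σ := fun ζ η => σ (ζ, η)) (𝓕 S).integrable
      (𝓕 S).continuous.measurable ?_ ?_ hrep s t u v
    · exact (Continuous.measurable (by fun_prop))
    · exact (Continuous.measurable (by fun_prop))
  · exact ENNReal.mul_ne_top (𝓕 S).integrable.2.ne (ENNReal.pow_ne_top ENNReal.ofReal_ne_top)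

/-- A smooth cutoff to a dyadic annulus around the unit circle. -/
def annulusCutoff (x : E2) : ℝ :=
  Real.smoothTransition (512 * ‖x‖ ^ 2 - 1) * Real.smoothTransition (2 - ‖x‖ ^ 2 / 256)

/-- A smooth positive function that coincides with the norm away from the origin. -/
def smoothNorm (x : E2) : ℝ := √(‖x‖ ^ 2 + Real.smoothTransition (1 - 512 * ‖x‖ ^ 2))

lemma annulusCutoff_contDiff : ContDiff ℝ ∞ annulusCutoff := by
  have h : ContDiff ℝ ∞ Real.smoothTransition := Real.smoothTransition.contDiff (n := ⊤)
  unfold annulusCutoff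
  have : ContDiff ℝ ∞ fun x : E2 => ‖x‖ ^ 2 := contDiff_norm_sq ℝ
  exact (h.comp ((contDiff_const.mul this).sub contDiff_const)).mul
    (h.comp (contDiff_const.sub (this.div_const _)))

lemma annulusCutoff_hasCompactSupport : HasCompactSupport annulusCutoff := by
  refine HasCompactSupport.intro (isCompact_closedBall (0 : E2) 32) fun x hx => ?_
  have : 32 < ‖x‖ := by simpa using hx
  rw [annulusCutoff, Real.smoothTransition.zero_of_nonpos (x := 2 - ‖x‖ ^ 2 / 256), mul_zero]
  nlinarith

lemma annulusCutoff_eq_one {x : E2} (h1 : 1 / 16 ≤ ‖x‖) (h2 : ‖x‖ ≤ 16) : annulusCutoff x = 1 := by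
  rw [annulusCutoff, Real.smoothTransition.one_of_one_le, Real.smoothTransition.one_of_one_le,
    mul_one] <;> nlinarith

lemma smoothNorm_aux_pos (x : E2) : 0 < ‖x‖ ^ 2 + Real.smoothTransition (1 - 512 * ‖x‖ ^ 2) := by
  rcases eq_or_ne x 0 with rfl | hx
  · simp
  · have := Real.smoothTransition.nonneg (1 - 512 * ‖x‖ ^ 2)
    positivity

lemma smoothNorm_pos (x : E2) : 0 < smoothNorm x := Real.sqrt_pos.2 (smoothNorm_aux_pos x)

lemma smoothNorm_contDiff : ContDiff ℝ ∞ smoothNorm := by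
  have h : ContDiff ℝ ∞ Real.smoothTransition := Real.smoothTransition.contDiff (n := ⊤)
  have h2 : ContDiff ℝ ∞ fun x : E2 => ‖x‖ ^ 2 := contDiff_norm_sq ℝ
  exact (h2.add (h.comp (contDiff_const.sub (contDiff_const.mul h2)))).sqrt
    fun x => (smoothNorm_aux_pos x).ne'

lemma smoothNorm_eq {x : E2} (h : 1 / 16 ≤ ‖x‖) : smoothNorm x = ‖x‖ := by
  rw [smoothNorm, Real.smoothTransition.zero_of_nonpos (by nlinarith), add_zero,
    Real.sqrt_sq (norm_nonneg _)]

/-- On inputs with frequencies in fixed dilates of an annulus, smooth symbols define bounded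
bilinear multipliers. -/
lemma exists_multiplier_le {n : E2 × E2 → ℝ} (hn : ContDiff ℝ ∞ n) :
    ∃ C : ℝ≥0, ∀ (s t : ℝ) (u v : 𝓢(E2, ℂ)),
      (∀ ζ, FT (fun x => u x) ζ ≠ 0 → 1 / 16 ≤ ‖s • ζ‖ ∧ ‖s • ζ‖ ≤ 16) →
      (∀ η, FT (fun x => v x) η ≠ 0 → 1 / 16 ≤ ‖t • η‖ ∧ ‖t • η‖ ≤ 16) →
      eLpNorm (fun ξ => ∫ η, (n (s • (ξ - η), t • η) : ℂ) *
        (FT (fun x => u x) (ξ - η) * FT (fun x => v x) η)) 2 volume ≤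
      C * (eLpNorm u 4 volume * eLpNorm v 4 volume) := by
  have hcut := annulusCutoff_contDiff
  have h1 : ContDiff ℝ ∞ fun p : E2 × E2 =>
      ((annulusCutoff p.1 * annulusCutoff p.2 * n p : ℝ) : ℂ) :=
    ofRealCLM.contDiff.comp (((hcut.comp contDiff_fst).mul (hcut.comp contDiff_snd)).mul hn)
  have h2 : HasCompactSupport fun p : E2 × E2 =>
      ((annulusCutoff p.1 * annulusCutoff p.2 * n p : ℝ) : ℂ) := by
    refine HasCompactSupport.intro
      (annulusCutoff_hasCompactSupport.isCompact.prod annulusCutoff_hasCompactSupport.isCompact)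
      fun p hp => ?_
    have : annulusCutoff p.1 = 0 ∨ annulusCutoff p.2 = 0 := by
      by_contra! h
      exact hp ⟨subset_tsupport _ h.1, subset_tsupport _ h.2⟩
    rcases this with h | h <;> simp [h]
  obtain ⟨C, hC⟩ := exists_multiplier_le_of_hasCompactSupport h1 h2
  refine ⟨C, fun s t u v hu hv => (le_of_eq ?_).trans (hC s t u v)⟩
  congr with ξ
  congr with η
  by_cases h1 : FT (fun x => u x) (ξ - η) = 0
  · simp [h1]
  by_cases h2 : FT (fun x => v x) η = 0
  · simp [h2]
  rw [annulusCutoff_eq_one (hu _ h1).1 (hu _ h1).2, annulusCutoff_eq_one (hv _ h2).1 (hv _ h2).2]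
  simp

/-- The dilate `2^{2k} φ₀(2^k ·)` as a Schwartz function. -/
def DyadicData.dilate (D : DyadicData) (k : ℤ) : 𝓢(E2, ℂ) :=
  (((2 : ℝ) ^ (2 * k) : ℝ) : ℂ) • SchwartzMap.compCLMOfContinuousLinearEquiv ℂ
    (ContinuousLinearEquiv.smulLeft (Units.mk0 ((2 : ℝ) ^ k) (by positivity))) D.φ

lemma DyadicData.dilate_apply (D : DyadicData) (k : ℤ) (x : E2) :
    D.dilate k x = (((2 : ℝ) ^ (2 * k) : ℝ) : ℂ) * D.φ ((2 : ℝ) ^ k • x) := rfl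

lemma DyadicData.FT_dilate (D : DyadicData) (k : ℤ) (ξ : E2) :
    FT (fun x => D.dilate k x) ξ = (D.Φ ((2 : ℝ) ^ (-k) • ξ) : ℂ) := by
  have h2 : ((2 : ℝ) ^ k) ≠ 0 := by positivity
  rw [← D.hFT]
  have := integral_comp_smul_E2
    (fun y => exp (-(I * ((⟪y, (2 : ℝ) ^ (-k) • ξ⟫ : ℝ) : ℂ))) * D.φ y) ((2 : ℝ) ^ k)
  unfold FT
  rw [eq_comm, ← eq_inv_smul_iff₀ (by positivity)] at this
  rw [this, inv_inv, ← integral_smul]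
  congr with x
  beta_reduce
  rw [D.dilate_apply, inner_smul_left, inner_smul_right, zpow_neg]
  simp only [conj_trivial, mul_inv_cancel_left₀ h2, Complex.real_smul]
  rw [mul_comm 2 k, zpow_mul]
  push_cast
  norm_cast
  ring

/-- The Littlewood-Paley pieces of a Schwartz function, as Schwartz functions. -/
def DyadicData.piece (D : DyadicData) (f : 𝓢(E2, ℂ)) (k : ℤ) : 𝓢(E2, ℂ) :=
  SchwartzMap.convolution (ContinuousLinearMap.mul ℂ ℂ) (D.dilate k) f

lemma DyadicData.piece_apply (D : DyadicData) (f : 𝓢(E2, ℂ)) (k : ℤ) (x : E2) :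
    D.piece f k x = convPhi D k (fun x => f x) x := by
  rw [piece, SchwartzMap.convolution_apply, MeasureTheory.convolution_mul]
  rfl

lemma DyadicData.FT_piece (D : DyadicData) (f : 𝓢(E2, ℂ)) (k : ℤ) (ξ : E2) :
    FT (fun x => D.piece f k x) ξ = D.Φ ((2 : ℝ) ^ (-k) • ξ) * FT (fun x => f x) ξ := by
  rw [← D.FT_dilate, FT_eq_fourier, FT_eq_fourier, FT_eq_fourier]
  have : 𝓕 (D.piece f k) = SchwartzMap.pairing (ContinuousLinearMap.mul ℂ ℂ)
    (𝓕 (D.dilate k)) (𝓕 f) := by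
    rw [piece]
    exact SchwartzMap.fourier_convolution _ _ _
  exact congrArg (fun F : 𝓢(E2, ℂ) => F ((2 * Real.pi)⁻¹ • ξ)) this

lemma DyadicData.continuous_Φ (D : DyadicData) : Continuous D.Φ := by
  have h := FT_continuous D.φ
  have : D.Φ = fun ξ => (FT (fun x => D.φ x) ξ).re := by
    ext ξ; rw [D.hFT, ofReal_re]
  rw [this]
  exact continuous_re.comp h

lemma DyadicData.Φ_scaled_support (D : DyadicData) {k : ℤ} {ξ : E2}
    (h : D.Φ ((2 : ℝ) ^ (-k) • ξ) ≠ 0) : (2 : ℝ) ^ (k - 1) ≤ ‖ξ‖ ∧ ‖ξ‖ ≤ (2 : ℝ) ^ (k + 1) := by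
  obtain ⟨h1, h2⟩ := D.hsupp _ h
  have hk : (0 : ℝ) < 2 ^ k := by positivity
  rw [norm_smul, zpow_neg, norm_inv, Real.norm_of_nonneg hk.le, inv_mul_eq_div] at h1 h2
  rw [le_div_iff₀ hk] at h1
  rw [div_le_iff₀ hk] at h2
  rw [zpow_sub_one₀ (by norm_num), zpow_add_one₀ (by norm_num)]
  constructor <;> linarith

lemma DyadicData.FT_piece_support (D : DyadicData) {f : 𝓢(E2, ℂ)} {k : ℤ} {ξ : E2}
    (h : FT (fun x => D.piece f k x) ξ ≠ 0) :
    (2 : ℝ) ^ (k - 1) ≤ ‖ξ‖ ∧ ‖ξ‖ ≤ (2 : ℝ) ^ (k + 1) := by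
  rw [D.FT_piece] at h
  exact D.Φ_scaled_support (by simpa using left_ne_zero_of_mul h)

/-- The symbol of the bilinear form `BHat`. -/
def BSymbol (ξ η : E2) : ℝ :=
  ⟪ξ, perp η⟫ * ⟪ξ, (2 : ℝ) • η - ξ⟫ / (‖ξ‖ ^ 2 * (‖η‖ + ‖ξ - η‖) * ‖ξ - η‖ * ‖η‖)

lemma BHat_eq (f g : 𝓢(E2, ℂ)) (ξ : E2) :
    BHat f g ξ = (1 / 2 : ℂ) * ∫ η, (BSymbol ξ η : ℂ) *
      (FT (fun x => f x) (ξ - η) * FT (fun x => g x) η) := by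
  simp only [BHat, BSymbol, mul_assoc]

lemma eLpNorm_BHat_le_of_symbol {ι : Type*} [Fintype ι] {n : ι → E2 × E2 → ℝ}
    (hn : ∀ i, ContDiff ℝ ∞ (n i)) :
    ∃ C : ℝ≥0, ∀ (s t A : ℝ) (c : ι → E2 → ℝ) (u v : 𝓢(E2, ℂ)), 0 < t →
      (∀ ζ, FT (fun x => u x) ζ ≠ 0 → 1 / 16 ≤ ‖s • ζ‖ ∧ ‖s • ζ‖ ≤ 16) →
      (∀ η, FT (fun x => v x) η ≠ 0 → 1 / 16 ≤ ‖t • η‖ ∧ ‖t • η‖ ≤ 16) →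
      (∀ i ξ, |c i ξ| ≤ A) →
      (∀ ξ η, FT (fun x => u x) (ξ - η) ≠ 0 → FT (fun x => v x) η ≠ 0 →
        BSymbol ξ η = ∑ i, c i ξ * n i (s • (ξ - η), t • η)) →
      eLpNorm (BHat u v) 2 volume ≤
        C * (ENNReal.ofReal A * (eLpNorm u 4 volume * eLpNorm v 4 volume)) := by
  choose C hC using fun i => exists_multiplier_le (hn i)
  refine ⟨∑ i, C i, fun s t A c u v ht hu hv hA hM => ?_⟩
  have hFu := FT_continuous u
  have hFv := FT_continuous v
  have hnc := fun i => (hn i).continuous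
  set J : ι → E2 → ℂ := fun i ξ => ∫ η, (n i (s • (ξ - η), t • η) : ℂ) *
        (FT (fun x => u x) (ξ - η) * FT (fun x => v x) η) with hJ
  have hJm : ∀ i, Measurable (J i) := by
    intro i
    refine (StronglyMeasurable.integral_prod_right' (f := fun q : E2 × E2 =>
      (n i (s • (q.1 - q.2), t • q.2) : ℂ) *
        (FT (fun x => u x) (q.1 - q.2) * FT (fun x => v x) q.2)) ?_).measurable
    have := hnc i
    exact Continuous.stronglyMeasurable (by fun_prop)
  have hint : ∀ i ξ, Integrable fun η => (n i (s • (ξ - η), t • η) : ℂ) *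
        (FT (fun x => u x) (ξ - η) * FT (fun x => v x) η) := by
    intro i ξ
    refine Continuous.integrable_of_hasCompactSupport ?_ ?_
    · have := hnc i
      fun_prop
    · refine HasCompactSupport.intro (isCompact_closedBall (0 : E2) (16 / t)) fun η hη => ?_
      by_contra h
      have h2 := (hv η (right_ne_zero_of_mul (right_ne_zero_of_mul h))).2
      rw [norm_smul, Real.norm_of_nonneg ht.le, mul_comm, ← le_div_iff₀ ht] at h2
      exact hη (by simpa using h2)
  have hB : ∀ ξ, BHat u v ξ = (1 / 2 : ℂ) * ∑ i, (c i ξ : ℂ) * J i ξ := by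
    intro ξ
    rw [BHat_eq]
    simp only [hJ, ← integral_const_mul]
    rw [← integral_finsetSum _ fun i _ => (hint i ξ).const_mul _]
    rw [← integral_const_mul]
    refine integral_congr_ae (.of_forall fun η => ?_)
    beta_reduce
    by_cases h1 : FT (fun x => u x) (ξ - η) = 0
    · simp [h1]
    by_cases h2 : FT (fun x => v x) η = 0
    · simp [h2]
    rw [hM ξ η h1 h2]
    push_cast
    rw [Finset.sum_mul]
    simp only [mul_assoc]
  rw [eLpNorm_two_eq_lTwo]
  calc lTwo volume (fun ξ => ‖BHat u v ξ‖ₑ)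
      ≤ lTwo volume (fun ξ => ∑' i, ENNReal.ofReal A * ‖J i ξ‖ₑ) := by
        refine lTwo_mono (.of_forall fun ξ => ?_)
        rw [hB, enorm_mul, tsum_fintype]
        have h12 : ‖(1 / 2 : ℂ)‖ₑ ≤ 1 := by
          rw [← ofReal_norm]
          exact ENNReal.ofReal_le_one.2 (by norm_num)
        refine (mul_le_of_le_one_left' h12).trans ((enorm_sum_le _ _).trans ?_)
        gcongr with i
        rw [enorm_mul, ← ofReal_norm, Complex.norm_real]
        gcongr
        exact hA i ξ
    _ ≤ ∑' i, lTwo volume (fun ξ => ENNReal.ofReal A * ‖J i ξ‖ₑ) :=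
        lTwo_tsum_le fun i => ((hJm i).enorm.const_mul _)
    _ ≤ ∑' i, ENNReal.ofReal A * (C i * (eLpNorm u 4 volume * eLpNorm v 4 volume)) := by
        gcongr with i
        rw [lTwo_const_mul _ (hJm i).enorm, ← eLpNorm_two_eq_lTwo]
        gcongr
        exact hC i s t u v hu hv
    _ = _ := by
        rw [tsum_fintype, ENNReal.ofNNReal_finsetSum, Finset.sum_mul]
        refine Finset.sum_congr rfl fun i _ => ?_
        ring

lemma inner_perp (ξ η : E2) : ⟪ξ, perp η⟫ = ξ 1 * η 0 - ξ 0 * η 1 := by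
  simp [perp, PiLp.inner_apply, Fin.sum_univ_two]
  ring

lemma inner_perp_sub (ξ η : E2) : ⟪ξ - η, perp η⟫ = ⟪ξ, perp η⟫ := by
  simp [inner_perp]; ring

lemma inner_two_smul_sub (ξ η : E2) :
    ⟪ξ, (2 : ℝ) • η - ξ⟫ = ‖η‖ ^ 2 - ‖ξ - η‖ ^ 2 := by
  rw [norm_sub_sq_real, inner_sub_right, inner_smul_right, real_inner_self_eq_norm_sq]
  ring

lemma norm_perp (η : E2) : ‖perp η‖ = ‖η‖ := by
  simp [perp, EuclideanSpace.norm_eq, Fin.sum_univ_two, add_comm]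

lemma abs_BSymbol_le (ξ η : E2) : |BSymbol ξ η| ≤ ‖ξ‖⁻¹ := by
  have h1 : |⟪ξ, perp η⟫| ≤ ‖ξ - η‖ * ‖η‖ := by
    rw [← inner_perp_sub, ← norm_perp η]
    exact abs_real_inner_le_norm _ _
  have h2 : |⟪ξ, (2 : ℝ) • η - ξ⟫| ≤ ‖ξ‖ * (‖η‖ + ‖ξ - η‖) := by
    refine (abs_real_inner_le_norm _ _).trans ?_
    gcongr
    rw [show (2 : ℝ) • η - ξ = η - (ξ - η) by rw [two_smul]; abel]
    exact norm_sub_le _ _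
  rw [BSymbol, abs_div, abs_mul, abs_of_nonneg (a := _ * ‖η‖) (by positivity)]
  refine div_le_of_le_mul₀ (by positivity) (by positivity) ((mul_le_mul h1 h2 (by positivity)
    (by positivity)).trans_eq ?_)
  rcases eq_or_ne ‖ξ‖ 0 with h | h
  · simp [h]
  · field_simp

lemma perp_contDiff : ContDiff ℝ ∞ perp := by
  rw [contDiff_euclidean]
  intro i
  fin_cases i
  · have : (fun η : E2 => perp η 0) = fun η => -η 1 := rfl
    change ContDiff ℝ ∞ fun η : E2 => -η 1
    fun_prop
  · change ContDiff ℝ ∞ fun η : E2 => η 0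
    fun_prop

lemma BSymbol_eq_near {s : ℝ} (hs : 0 < s) {ξ η : E2} (h1 : 1 / 16 ≤ ‖s • (ξ - η)‖)
    (h2 : 1 / 16 ≤ ‖s • η‖) :
    BSymbol ξ η = ∑ i : Fin 2 × Fin 2, s * (ξ i.1 * ξ i.2) / ‖ξ‖ ^ 2 *
      (perp (s • η) i.1 * (s • η - s • (ξ - η)) i.2 /
        ((smoothNorm (s • η) + smoothNorm (s • (ξ - η))) * smoothNorm (s • (ξ - η)) *
          smoothNorm (s • η))) := by
  rw [smoothNorm_eq h1, smoothNorm_eq h2, norm_smul, norm_smul, Real.norm_of_nonneg hs.le]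
  rw [norm_smul, Real.norm_of_nonneg hs.le] at h1 h2
  have hζ : 0 < ‖ξ - η‖ := by
    by_contra! h
    nlinarith [mul_nonneg hs.le (neg_nonneg.2 h)]
  have hη : 0 < ‖η‖ := by
    by_contra! h
    nlinarith [mul_nonneg hs.le (neg_nonneg.2 h)]
  rcases eq_or_ne ‖ξ‖ 0 with h | h
  · simp [BSymbol, h]
  simp only [BSymbol, PiLp.inner_apply, Fintype.sum_prod_type, Fin.sum_univ_two, perp]
  simp
  field_simp
  ring

lemma norm_smul_zpow_mem {k m : ℤ} (h : |m - k| ≤ 3) {ζ : E2}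
    (hζ : (2 : ℝ) ^ (k - 1) ≤ ‖ζ‖ ∧ ‖ζ‖ ≤ (2 : ℝ) ^ (k + 1)) :
    1 / 16 ≤ ‖(2 : ℝ) ^ (-m) • ζ‖ ∧ ‖(2 : ℝ) ^ (-m) • ζ‖ ≤ 16 := by
  have hm : (0 : ℝ) < 2 ^ (-m) := by positivity
  rw [norm_smul, Real.norm_of_nonneg hm.le]
  constructor
  · calc (1 / 16 : ℝ) = 2 ^ (-4 : ℤ) := by norm_num
      _ ≤ 2 ^ (-m + (k - 1)) := zpow_le_zpow_right₀ (by norm_num) (by grind)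
      _ = 2 ^ (-m) * 2 ^ (k - 1) := zpow_add₀ (by norm_num) _ _
      _ ≤ _ := by gcongr; exact hζ.1
  · calc (2 : ℝ) ^ (-m) * ‖ζ‖ ≤ 2 ^ (-m) * 2 ^ (k + 1) := by gcongr; exact hζ.2
      _ = 2 ^ (-m + (k + 1)) := (zpow_add₀ (by norm_num) _ _).symm
      _ ≤ 2 ^ (4 : ℤ) := zpow_le_zpow_right₀ (by norm_num) (by grind)
      _ = 16 := by norm_num

/-- Comparable input frequencies. -/
lemma exists_eLpNorm_BHat_le_near :
    ∃ C : ℝ≥0, ∀ (k l : ℤ) (u v : 𝓢(E2, ℂ)), |k - l| ≤ 3 →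
      (∀ ζ, FT (fun x => u x) ζ ≠ 0 → (2 : ℝ) ^ (k - 1) ≤ ‖ζ‖ ∧ ‖ζ‖ ≤ (2 : ℝ) ^ (k + 1)) →
      (∀ η, FT (fun x => v x) η ≠ 0 → (2 : ℝ) ^ (l - 1) ≤ ‖η‖ ∧ ‖η‖ ≤ (2 : ℝ) ^ (l + 1)) →
      eLpNorm (BHat u v) 2 volume ≤ C * (ENNReal.ofReal ((2 : ℝ) ^ (-(max k l))) *
        (eLpNorm u 4 volume * eLpNorm v 4 volume)) := by
  have hn : ∀ i : Fin 2 × Fin 2, ContDiff ℝ ∞ fun p : E2 × E2 => perp p.2 i.1 * (p.2 - p.1) i.2 /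
      ((smoothNorm p.2 + smoothNorm p.1) * smoothNorm p.1 * smoothNorm p.2) := by
    intro i
    have h1 := smoothNorm_contDiff.comp (contDiff_fst (𝕜 := ℝ) (E := E2) (F := E2) (n := ∞))
    have h2 := smoothNorm_contDiff.comp (contDiff_snd (𝕜 := ℝ) (E := E2) (F := E2) (n := ∞))
    have h3 := (contDiff_euclidean.1 perp_contDiff i.1).comp
      (contDiff_snd (𝕜 := ℝ) (E := E2) (F := E2) (n := ∞))
    refine (h3.mul (by fun_prop)).div (((h2.add h1).mul h1).mul h2) fun p => ?_
    have := smoothNorm_pos p.1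
    have := smoothNorm_pos p.2
    positivity
  obtain ⟨C, hC⟩ := eLpNorm_BHat_le_of_symbol hn
  refine ⟨C * 8, fun k l u v hkl hu hv => ?_⟩
  have hk : (0 : ℝ) < 2 ^ (-k) := by positivity
  have hsu : ∀ ζ, FT (fun x => u x) ζ ≠ 0 →
      1 / 16 ≤ ‖(2 : ℝ) ^ (-k) • ζ‖ ∧ ‖(2 : ℝ) ^ (-k) • ζ‖ ≤ 16 := by
    intro ζ h
    exact norm_smul_zpow_mem (m := k) (by simp) (hu ζ h)
  have hsv : ∀ η, FT (fun x => v x) η ≠ 0 →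
      1 / 16 ≤ ‖(2 : ℝ) ^ (-k) • η‖ ∧ ‖(2 : ℝ) ^ (-k) • η‖ ≤ 16 := by
    intro η h
    exact norm_smul_zpow_mem hkl (hv η h)
  refine (hC (2 ^ (-k)) (2 ^ (-k)) (2 ^ (-k))
    (fun i ξ => 2 ^ (-k) * (ξ i.1 * ξ i.2) / ‖ξ‖ ^ 2) u v hk hsu hsv ?_ ?_).trans ?_
  · intro i ξ
    rw [abs_div, abs_of_nonneg (a := ‖ξ‖ ^ 2) (by positivity), abs_mul, abs_mul,
      abs_of_nonneg hk.le]
    refine div_le_of_le_mul₀ (by positivity) hk.le ?_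
    rw [sq]
    gcongr
    · exact PiLp.norm_apply_le ξ i.1
    · exact PiLp.norm_apply_le ξ i.2
  · intro ξ η h1 h2
    exact BSymbol_eq_near hk (hsu _ h1).1 (hsv _ h2).1
  · push_cast
    rw [mul_assoc, ← mul_assoc 8]
    gcongr
    rw [show (8 : ℝ≥0∞) = ENNReal.ofReal 8 by simp, ← ENNReal.ofReal_mul (by norm_num)]
    gcongr
    rw [show (8 : ℝ) = 2 ^ (3 : ℤ) by norm_num, ← zpow_add₀ (by norm_num)]
    exact zpow_le_zpow_right₀ (by norm_num) (by grind)

lemma BSymbol_eq_far {s t : ℝ} (hs : 0 < s) (ht : 0 < t) {ξ η : E2}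
    (h1 : 1 / 16 ≤ ‖s • (ξ - η)‖) (h2 : 1 / 16 ≤ ‖t • η‖) :
    BSymbol ξ η =
      t⁻¹ / ‖ξ‖ ^ 2 * (⟪s • (ξ - η), perp (t • η)⟫ / smoothNorm (s • (ξ - η))) +
      -s⁻¹ / ‖ξ‖ ^ 2 * (⟪s • (ξ - η), perp (t • η)⟫ / smoothNorm (t • η)) := by
  have hst : ⟪s • (ξ - η), perp (t • η)⟫ = s * t * ⟪ξ, perp η⟫ := by
    rw [← inner_perp_sub ξ η]
    simp [inner_perp]
    ring
  rw [smoothNorm_eq h1, smoothNorm_eq h2, hst, norm_smul, norm_smul, Real.norm_of_nonneg hs.le,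
    Real.norm_of_nonneg ht.le]
  rw [norm_smul, Real.norm_of_nonneg hs.le] at h1
  rw [norm_smul, Real.norm_of_nonneg ht.le] at h2
  have hζ : 0 < ‖ξ - η‖ := by
    by_contra! h
    nlinarith [mul_nonneg hs.le (neg_nonneg.2 h)]
  have hη : 0 < ‖η‖ := by
    by_contra! h
    nlinarith [mul_nonneg ht.le (neg_nonneg.2 h)]
  rw [BSymbol, inner_two_smul_sub]
  rcases eq_or_ne ‖ξ‖ 0 with h | h
  · simp [h]
  field_simp
  ring

lemma zpow_le_norm_of_far {k l : ℤ} (hkl : 3 < |k - l|) {ξ η : E2}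
    (h1 : (2 : ℝ) ^ (k - 1) ≤ ‖ξ - η‖ ∧ ‖ξ - η‖ ≤ (2 : ℝ) ^ (k + 1))
    (h2 : (2 : ℝ) ^ (l - 1) ≤ ‖η‖ ∧ ‖η‖ ≤ (2 : ℝ) ^ (l + 1)) :
    (2 : ℝ) ^ (max k l - 2) ≤ ‖ξ‖ := by
  have t1 : ‖ξ - η‖ ≤ ‖ξ‖ + ‖η‖ := norm_sub_le _ _
  have t2 : ‖η‖ ≤ ‖ξ‖ + ‖ξ - η‖ := by
    simpa using norm_sub_le ξ (ξ - η)
  have key : ∀ m n : ℤ, n + 4 ≤ m →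
      (2 : ℝ) ^ (m - 2) + (2 : ℝ) ^ (n + 1) ≤ (2 : ℝ) ^ (m - 1) := by
    intro m n h
    have a : (2 : ℝ) ^ (n + 1) ≤ 2 ^ (m - 2) := zpow_le_zpow_right₀ (by norm_num) (by omega)
    have b : (2 : ℝ) ^ (m - 1) = 2 * 2 ^ (m - 2) := by
      rw [← zpow_one_add₀ (by norm_num)]; congr 1; ring
    linarith
  rcases le_total k l with h | h
  · rw [max_eq_right h]
    have := key l k (by grind)
    linarith
  · rw [max_eq_left h]
    have := key k l (by grind)
    linarith

/-- Separated input frequencies. -/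
lemma exists_eLpNorm_BHat_le_far :
    ∃ C : ℝ≥0, ∀ (k l : ℤ) (u v : 𝓢(E2, ℂ)), 3 < |k - l| →
      (∀ ζ, FT (fun x => u x) ζ ≠ 0 → (2 : ℝ) ^ (k - 1) ≤ ‖ζ‖ ∧ ‖ζ‖ ≤ (2 : ℝ) ^ (k + 1)) →
      (∀ η, FT (fun x => v x) η ≠ 0 → (2 : ℝ) ^ (l - 1) ≤ ‖η‖ ∧ ‖η‖ ≤ (2 : ℝ) ^ (l + 1)) →
      eLpNorm (BHat u v) 2 volume ≤ C * (ENNReal.ofReal ((2 : ℝ) ^ (-(max k l))) *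
        (eLpNorm u 4 volume * eLpNorm v 4 volume)) := by
  have hn : ∀ b : Bool, ContDiff ℝ ∞ fun p : E2 × E2 =>
      ⟪p.1, perp p.2⟫ / smoothNorm (bif b then p.1 else p.2) := by
    intro b
    have h3 := perp_contDiff.comp (contDiff_snd (𝕜 := ℝ) (E := E2) (F := E2) (n := ∞))
    refine (contDiff_fst.inner ℝ h3).div ?_ fun p => (smoothNorm_pos _).ne'
    cases b
    · exact smoothNorm_contDiff.comp contDiff_snd
    · exact smoothNorm_contDiff.comp contDiff_fst
  obtain ⟨C, hC⟩ := eLpNorm_BHat_le_of_symbol hn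
  refine ⟨C * 16, fun k l u v hkl hu hv => ?_⟩
  have hs : (0 : ℝ) < 2 ^ (-k) := by positivity
  have ht : (0 : ℝ) < 2 ^ (-l) := by positivity
  have hsu : ∀ ζ, FT (fun x => u x) ζ ≠ 0 →
      1 / 16 ≤ ‖(2 : ℝ) ^ (-k) • ζ‖ ∧ ‖(2 : ℝ) ^ (-k) • ζ‖ ≤ 16 :=
    fun ζ h => norm_smul_zpow_mem (by simp) (hu ζ h)
  have hsv : ∀ η, FT (fun x => v x) η ≠ 0 →
      1 / 16 ≤ ‖(2 : ℝ) ^ (-l) • η‖ ∧ ‖(2 : ℝ) ^ (-l) • η‖ ≤ 16 :=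
    fun η h => norm_smul_zpow_mem (by simp) (hv η h)
  refine (hC (2 ^ (-k)) (2 ^ (-l)) (16 * 2 ^ (-(max k l)))
    (fun b ξ => if (2 : ℝ) ^ (max k l - 2) ≤ ‖ξ‖ then
      (bif b then ((2 : ℝ) ^ (-l))⁻¹ else -((2 : ℝ) ^ (-k))⁻¹) / ‖ξ‖ ^ 2 else 0)
    u v ht hsu hsv ?_ ?_).trans ?_
  · intro b ξ
    split_ifs with h
    · rw [abs_div, abs_of_nonneg (a := ‖ξ‖ ^ 2) (by positivity)]
      refine div_le_of_le_mul₀ (by positivity) (by positivity) ?_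
      calc _ ≤ (2 : ℝ) ^ (max k l) := by
            cases b
            · simp [abs_of_nonneg (a := (2 : ℝ) ^ k) (by positivity)]
            · simp [abs_of_nonneg (a := (2 : ℝ) ^ l) (by positivity)]
        _ = 16 * 2 ^ (-(max k l)) * (2 ^ (max k l - 2)) ^ 2 := by
            rw [zpow_sub₀ (by norm_num), zpow_neg]
            field_simp
            norm_num
        _ ≤ _ := by gcongr
    · simp
      positivity
  · intro ξ η h1 h2
    simp only [Fintype.sum_bool, cond_true, cond_false,
      if_pos (zpow_le_norm_of_far hkl (hu _ h1) (hv _ h2))]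
    exact BSymbol_eq_far hs ht (hsu _ h1).1 (hsv _ h2).1
  · push_cast
    rw [mul_assoc, ← mul_assoc 16, ENNReal.ofReal_mul (by norm_num)]
    simp

lemma exists_eLpNorm_BHat_le :
    ∃ C : ℝ≥0, ∀ (k l : ℤ) (u v : 𝓢(E2, ℂ)),
      (∀ ζ, FT (fun x => u x) ζ ≠ 0 → (2 : ℝ) ^ (k - 1) ≤ ‖ζ‖ ∧ ‖ζ‖ ≤ (2 : ℝ) ^ (k + 1)) →
      (∀ η, FT (fun x => v x) η ≠ 0 → (2 : ℝ) ^ (l - 1) ≤ ‖η‖ ∧ ‖η‖ ≤ (2 : ℝ) ^ (l + 1)) →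
      eLpNorm (BHat u v) 2 volume ≤ C * (ENNReal.ofReal ((2 : ℝ) ^ (-(max k l))) *
        (eLpNorm u 4 volume * eLpNorm v 4 volume)) := by
  obtain ⟨C₁, h₁⟩ := exists_eLpNorm_BHat_le_near
  obtain ⟨C₂, h₂⟩ := exists_eLpNorm_BHat_le_far
  refine ⟨max C₁ C₂, fun k l u v hu hv => ?_⟩
  rcases le_or_gt |k - l| 3 with h | h
  · refine (h₁ k l u v h hu hv).trans ?_
    gcongr
    exact le_max_left _ _
  · refine (h₂ k l u v h hu hv).trans ?_
    gcongr
    exact le_max_right _ _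

lemma measurable_BSymbol : Measurable (Function.uncurry BSymbol) := by
  have := perp_contDiff.continuous.measurable
  unfold BSymbol Function.uncurry
  fun_prop

lemma measurable_BHat (f g : 𝓢(E2, ℂ)) : Measurable (BHat f g) := by
  have h1 := (FT_continuous f).measurable
  have h2 := (FT_continuous g).measurable
  have h3 := measurable_BSymbol
  have : Measurable fun ξ => ∫ η, (BSymbol ξ η : ℂ) *
      (FT (fun x => f x) (ξ - η) * FT (fun x => g x) η) := by
    refine (StronglyMeasurable.integral_prod_right' (f := fun q : E2 × E2 =>
      ((Function.uncurry BSymbol q : ℝ) : ℂ) *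
        (FT (fun x => f x) (q.1 - q.2) * FT (fun x => g x) q.2)) ?_).measurable
    exact Measurable.stronglyMeasurable (by fun_prop)
  rw [funext (BHat_eq f g)]
  exact this.const_mul _

lemma integrable_BHat_integrand (f g : 𝓢(E2, ℂ)) (ξ : E2) :
    Integrable fun η => (BSymbol ξ η : ℂ) *
      (FT (fun x => f x) (ξ - η) * FT (fun x => g x) η) := by
  obtain ⟨C, hC⟩ := FT_bounded f
  have hm : Measurable fun η => BSymbol ξ η := measurable_BSymbol.of_uncurry_left
  have hf := (FT_continuous f).measurable
  have hg := (FT_continuous g).measurable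
  refine ((FT_integrable g).norm.const_mul (‖ξ‖⁻¹ * C)).mono' ?_ (.of_forall fun η => ?_)
  · exact (Measurable.aestronglyMeasurable (by fun_prop))
  · rw [norm_mul, norm_mul, Complex.norm_real, mul_assoc]
    gcongr
    · exact abs_BSymbol_le ξ η
    · exact hC _

lemma DyadicData.hasSum_prod (D : DyadicData) {ζ η : E2} (hζ : ζ ≠ 0) (hη : η ≠ 0) :
    HasSum (fun p : ℤ × ℤ => D.Φ ((2 : ℝ) ^ (-p.1) • ζ) * D.Φ ((2 : ℝ) ^ (-p.2) • η)) 1 := by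
  have := (D.hsum ζ hζ).mul (D.hsum η hη) ((D.hsum ζ hζ).summable.mul_of_nonneg
    (D.hsum η hη).summable (fun _ => D.h0 _) (fun _ => D.h0 _))
  simpa using this

lemma hasSum_BHat_piece (D : DyadicData) (f g : 𝓢(E2, ℂ)) (ξ : E2) :
    HasSum (fun p : ℤ × ℤ => BHat (D.piece f p.1) (D.piece g p.2) ξ) (BHat f g ξ) := by
  simp only [BHat_eq]
  refine HasSum.mul_left _ ?_
  set h : E2 → ℂ := fun η => (BSymbol ξ η : ℂ) *
      (FT (fun x => f x) (ξ - η) * FT (fun x => g x) η) with hh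
  have hi : Integrable h := integrable_BHat_integrand f g ξ
  set Ψ : ℤ × ℤ → E2 → ℝ := fun p η =>
    D.Φ ((2 : ℝ) ^ (-p.1) • (ξ - η)) * D.Φ ((2 : ℝ) ^ (-p.2) • η) with hΨ
  have hsum : ∀ᵐ η : E2, HasSum (fun p => Ψ p η) 1 := by
    have h1 : ∀ᵐ η : E2, η ≠ 0 := by simp [ae_iff]
    have h2 : ∀ᵐ η : E2, η ≠ ξ := by simp [ae_iff]
    filter_upwards [h1, h2] with η h1 h2
    exact D.hasSum_prod (sub_ne_zero.2 h2.symm) h1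
  have hpt : ∀ (p : ℤ × ℤ) η, (BSymbol ξ η : ℂ) * (FT (fun x => D.piece f p.1 x) (ξ - η) *
      FT (fun x => D.piece g p.2 x) η) = (Ψ p η : ℂ) * h η := by
    intro p η
    simp only [D.FT_piece, hh, hΨ]
    push_cast
    ring
  refine hasSum_integral_of_dominated_convergence (fun p η => Ψ p η * ‖h η‖)
    (fun p => (integrable_BHat_integrand _ _ ξ).aestronglyMeasurable)
    (fun p => .of_forall fun η => ?_) ?_ ?_ ?_
  · rw [hpt, norm_mul, Complex.norm_real, Real.norm_of_nonneg (mul_nonneg (D.h0 _) (D.h0 _))]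
  · filter_upwards [hsum] with η hη
    exact hη.summable.mul_right _
  · refine hi.norm.congr ?_
    filter_upwards [hsum] with η hη
    rw [tsum_mul_right, hη.tsum_eq, one_mul]
  · filter_upwards [hsum] with η hη
    simp only [hpt]
    have := (Complex.hasSum_ofReal.2 hη).mul_right (h η)
    simpa using this

lemma eLpNorm_BHat_le_tsum (D : DyadicData) (f g : 𝓢(E2, ℂ)) :
    eLpNorm (BHat f g) 2 volume ≤
      ∑' p : ℤ × ℤ, eLpNorm (BHat (D.piece f p.1) (D.piece g p.2)) 2 volume := by
  simp only [eLpNorm_two_eq_lTwo]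
  refine le_trans (lTwo_mono (.of_forall fun ξ => ?_))
    (lTwo_tsum_le fun p => (measurable_BHat (D.piece f p.1) (D.piece g p.2)).enorm)
  rw [← (hasSum_BHat_piece D f g ξ).tsum_eq]
  exact enorm_tsum_le_tsum_enorm

lemma tsum_two_rpow_ne_top :
    ∑' r : ℤ, ENNReal.ofReal ((2 : ℝ) ^ (-|(r : ℝ)| / 2)) ≠ ⊤ := by
  have hg : Summable fun n : ℕ => (2 : ℝ) ^ (-(n : ℝ) / 2) := by
    have : Summable fun n : ℕ => ((2 : ℝ) ^ (-(1 / 2) : ℝ)) ^ n :=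
      summable_geometric_of_lt_one (by positivity)
        (Real.rpow_lt_one_of_one_lt_of_neg (by norm_num) (by norm_num))
    refine this.congr fun n => ?_
    rw [← Real.rpow_natCast, ← Real.rpow_mul (by norm_num)]
    congr 1
    ring
  refine Summable.tsum_ofReal_ne_top ?_
  refine Summable.of_nat_of_neg ?_ ?_ <;> simpa using hg

/-- The Besov norm occurring in the bilinear estimate, with `a k` in the role of the `L⁴` norm of
the `k`-th Littlewood-Paley piece. -/
def besovSum (a : ℤ → ℝ≥0∞) : ℝ≥0∞ :=
  (∑' j : ℤ, ((2 : ℝ≥0∞) ^ (-(j : ℝ) / 2) * a j) ^ (2 : ℕ)) ^ ((1 : ℝ) / 2)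

lemma ofReal_two_zpow_neg_max (k l : ℤ) :
    ENNReal.ofReal ((2 : ℝ) ^ (-(max k l))) =
      ENNReal.ofReal ((2 : ℝ) ^ (-|((l - k : ℤ) : ℝ)| / 2)) *
        ((2 : ℝ≥0∞) ^ (-(k : ℝ) / 2) * (2 : ℝ≥0∞) ^ (-(l : ℝ) / 2)) := by
  have h2 : (2 : ℝ≥0∞) = ENNReal.ofReal 2 := by simp
  rw [h2, ENNReal.ofReal_rpow_of_pos (by norm_num), ENNReal.ofReal_rpow_of_pos (by norm_num),
    ← ENNReal.ofReal_mul (by positivity), ← ENNReal.ofReal_mul (by positivity),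
    ← Real.rpow_add (by norm_num), ← Real.rpow_add (by norm_num), ← Real.rpow_intCast]
  congr 2
  push_cast
  rcases le_total (k : ℝ) l with h | h
  · rw [max_eq_right h, abs_of_nonneg (by linarith)]; ring
  · rw [max_eq_left h, abs_of_nonpos (by linarith)]; ring

/-- The bilinear form maps `Ḃ^{-1/2}_{4,2} × Ḃ^{-1/2}_{4,2}` to `L²` (on the Fourier side). -/
lemma exists_eLpNorm_BHat_le_besovSum (D : DyadicData) :
    ∃ C : ℝ≥0, ∀ f g : 𝓢(E2, ℂ), eLpNorm (BHat f g) 2 volume ≤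
      C * (besovSum (fun k => eLpNorm (D.piece f k) 4 volume) *
        besovSum (fun k => eLpNorm (D.piece g k) 4 volume)) := by
  obtain ⟨C, hC⟩ := exists_eLpNorm_BHat_le
  set S := ∑' r : ℤ, ENNReal.ofReal ((2 : ℝ) ^ (-|(r : ℝ)| / 2)) with hS
  refine ⟨C * S.toNNReal, fun f g => ?_⟩
  rw [ENNReal.coe_mul, ENNReal.coe_toNNReal tsum_two_rpow_ne_top]
  calc _ ≤ ∑' p : ℤ × ℤ, eLpNorm (BHat (D.piece f p.1) (D.piece g p.2)) 2 volume :=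
        eLpNorm_BHat_le_tsum D f g
    _ ≤ ∑' p : ℤ × ℤ, (C : ℝ≥0∞) * (ENNReal.ofReal ((2 : ℝ) ^ (-|((p.2 - p.1 : ℤ) : ℝ)| / 2)) *
          (((2 : ℝ≥0∞) ^ (-(p.1 : ℝ) / 2) * eLpNorm (D.piece f p.1) 4 volume) *
          ((2 : ℝ≥0∞) ^ (-(p.2 : ℝ) / 2) * eLpNorm (D.piece g p.2) 4 volume))) := by
        gcongr with p
        refine (hC p.1 p.2 _ _ (fun _ => D.FT_piece_support)
          (fun _ => D.FT_piece_support)).trans_eq ?_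
        rw [ofReal_two_zpow_neg_max]
        ring
    _ ≤ _ := by
        rw [ENNReal.tsum_mul_left, mul_assoc]
        gcongr
        exact tsum_kernel_mul_le (fun r : ℤ => ENNReal.ofReal ((2 : ℝ) ^ (-|(r : ℝ)| / 2)))
          (fun k => (2 : ℝ≥0∞) ^ (-(k : ℝ) / 2) * eLpNorm (D.piece f k) 4 volume)
          (fun k => (2 : ℝ≥0∞) ^ (-(k : ℝ) / 2) * eLpNorm (D.piece g k) 4 volume)

lemma lintegral_enorm_le_of_support_ball {H : E2 → ℂ} (hH : Measurable H) {R : ℝ} (hR : 0 ≤ R)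
    (hs : ∀ ξ, R < ‖ξ‖ → H ξ = 0) :
    ∫⁻ ξ, ‖H ξ‖ₑ ≤ ENNReal.ofReal R * volume (Metric.ball (0 : E2) 1) ^ (1 / 2 : ℝ) *
      eLpNorm H 2 volume := by
  set s := Metric.closedBall (0 : E2) R
  have hsm : MeasurableSet s := Metric.isClosed_closedBall.measurableSet
  have h1 : ∀ ξ, ‖H ξ‖ₑ = s.indicator 1 ξ * ‖H ξ‖ₑ := by
    intro ξ
    by_cases h : ξ ∈ s
    · simp [h]
    · rw [hs ξ (by simpa [s] using h)]
      simp
  have h2 : lTwo volume (s.indicator (1 : E2 → ℝ≥0∞)) =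
      ENNReal.ofReal R * volume (Metric.ball (0 : E2) 1) ^ (1 / 2 : ℝ) := by
    have : ∀ ξ, s.indicator (1 : E2 → ℝ≥0∞) ξ ^ 2 = s.indicator 1 ξ := by
      intro ξ
      by_cases h : ξ ∈ s <;> simp [h]
    rw [lTwo]
    simp only [this]
    rw [lintegral_indicator_one hsm, Measure.addHaar_closedBall _ _ hR, finrank_E2,
      ENNReal.mul_rpow_of_nonneg _ _ (by norm_num), ENNReal.ofReal_pow hR, ENNReal.sq_rpow_half]
  rw [lintegral_congr h1, ← h2, eLpNorm_two_eq_lTwo]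
  exact lintegral_mul_le_lTwo (measurable_one.indicator hsm) hH.enorm

/-- Bernstein's inequality for the Littlewood-Paley pieces. -/
lemma exists_eLpNorm_DeltaB_le (D : DyadicData) :
    ∃ C : ℝ≥0, 0 < C ∧ ∀ (f g : 𝓢(E2, ℂ)) (j : ℤ),
      (2 : ℝ≥0∞) ^ (-(j : ℝ) / 2) * eLpNorm (DeltaB D f g j) 4 volume ≤
        C * lTwo volume (fun ξ => ENNReal.ofReal (D.Φ ((2 : ℝ) ^ (-j) • ξ)) * ‖BHat f g ξ‖ₑ) := by
  set V := volume (Metric.ball (0 : E2) 1) ^ (1 / 2 : ℝ) with hV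
  have hV0 : V ≠ 0 := by
    simpa [hV] using (Metric.measure_ball_pos volume (0 : E2) one_pos).ne'
  have hVt : V ≠ ⊤ := by
    simp [hV]
  set K := (2 * V * ENNReal.ofReal (2 * Real.pi)) ^ (1 / 2 : ℝ) with hK
  have hin0 : 2 * V * ENNReal.ofReal (2 * Real.pi) ≠ 0 := by
    have : ENNReal.ofReal (2 * Real.pi) ≠ 0 := by
      simpa using Real.pi_pos
    simp only [ne_eq, mul_eq_zero, not_or]
    exact ⟨⟨by norm_num, hV0⟩, this⟩
  have hint : 2 * V * ENNReal.ofReal (2 * Real.pi) ≠ ⊤ :=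
    ENNReal.mul_ne_top (ENNReal.mul_ne_top (by norm_num) hVt) ENNReal.ofReal_ne_top
  have hK0 : K ≠ 0 := by
    rw [hK]; exact (ENNReal.rpow_pos (pos_iff_ne_zero.2 hin0) hint).ne'
  have hKt : K ≠ ⊤ := ENNReal.rpow_ne_top_of_nonneg (by norm_num) hint
  refine ⟨K.toNNReal, ENNReal.toNNReal_pos hK0 hKt, fun f g j => ?_⟩
  rw [ENNReal.coe_toNNReal hKt]
  have hΦ := D.continuous_Φ
  have hB := measurable_BHat f g
  set H : E2 → ℂ := fun ξ => (D.Φ ((2 : ℝ) ^ (-j) • ξ) : ℂ) * BHat f g ξ with hH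
  have hHm : Measurable H := by
    have : Measurable fun ξ : E2 => D.Φ ((2 : ℝ) ^ (-j) • ξ) :=
      Continuous.measurable (by fun_prop)
    fun_prop
  have hN : eLpNorm H 2 volume =
      lTwo volume (fun ξ => ENNReal.ofReal (D.Φ ((2 : ℝ) ^ (-j) • ξ)) * ‖BHat f g ξ‖ₑ) := by
    rw [eLpNorm_two_eq_lTwo]
    congr with ξ
    rw [hH, enorm_mul, ← ofReal_norm, Complex.norm_real, Real.norm_of_nonneg (D.h0 _)]
  rw [← hN]
  rcases eq_or_ne (eLpNorm H 2 volume) ⊤ with htop | htop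
  · rw [htop, ENNReal.mul_top hK0]
    exact le_top
  have hmem : MemLp H 2 := ⟨hHm.aestronglyMeasurable, htop.lt_top⟩
  have h1 := lintegral_enorm_le_of_support_ball hHm (R := 2 ^ (j + 1)) (by positivity) (by
    intro ξ hξ
    by_contra h
    exact hξ.not_ge (D.Φ_scaled_support (by simpa using left_ne_zero_of_mul h)).2)
  have hHi : Integrable H := ⟨hHm.aestronglyMeasurable, h1.trans_lt
    (ENNReal.mul_ne_top (ENNReal.mul_ne_top ENNReal.ofReal_ne_top hVt) htop).lt_top⟩
  have hD : eLpNorm (DeltaB D f g j) 4 volume ≤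
      eLpNorm (fun x : E2 => ∫ ξ : E2, exp (I * ((⟪x, ξ⟫ : ℝ) : ℂ)) * H ξ) 4 volume := by
    refine eLpNorm_mono fun x => ?_
    rw [DeltaB, norm_mul]
    simp only [hH, mul_assoc]
    refine mul_le_of_le_one_left (norm_nonneg _) ?_
    rw [norm_inv, Complex.norm_real, Real.norm_of_nonneg (by positivity)]
    refine inv_le_one_of_one_le₀ ?_
    nlinarith [Real.pi_gt_three]
  calc _ ≤ (2 : ℝ≥0∞) ^ (-(j : ℝ) / 2) * ((ENNReal.ofReal (2 ^ (j + 1)) * V * eLpNorm H 2 volume) *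
        (ENNReal.ofReal (2 * Real.pi) * eLpNorm H 2 volume)) ^ (1 / 2 : ℝ) := by
        gcongr
        exact hD.trans ((eLpNorm_four_le hHi hmem).trans (by gcongr))
    _ = (2 : ℝ≥0∞) ^ (-(j : ℝ) / 2) * (((2 : ℝ≥0∞) ^ (j : ℝ)) *
        (2 * V * ENNReal.ofReal (2 * Real.pi)) * eLpNorm H 2 volume ^ 2) ^ (1 / 2 : ℝ) := by
        have : ENNReal.ofReal (2 ^ (j + 1)) = (2 : ℝ≥0∞) ^ (j : ℝ) * 2 := by
          rw [zpow_add_one₀ (by norm_num), ENNReal.ofReal_mul (by positivity), ← Real.rpow_intCast,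
            ← ENNReal.ofReal_rpow_of_pos (by norm_num)]
          simp
        rw [this]
        congr 2
        ring
    _ = (2 : ℝ≥0∞) ^ (-(j : ℝ) / 2) * (2 : ℝ≥0∞) ^ ((j : ℝ) / 2) * (K * eLpNorm H 2 volume) := by
        rw [ENNReal.mul_rpow_of_nonneg _ _ (by norm_num),
          ENNReal.mul_rpow_of_nonneg _ _ (by norm_num), ENNReal.sq_rpow_half, ← ENNReal.rpow_mul,
          mul_one_div, hK]
        ring
    _ = _ := by
        rw [← ENNReal.rpow_add _ _ (by norm_num) (by norm_num), neg_div, neg_add_cancel,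
          ENNReal.rpow_zero, one_mul]

lemma DyadicData.tsum_sq_le_one (D : DyadicData) (ξ : E2) :
    ∑' j : ℤ, ENNReal.ofReal (D.Φ ((2 : ℝ) ^ (-j) • ξ)) ^ 2 ≤ 1 := by
  rcases eq_or_ne ξ 0 with rfl | hξ
  · have : D.Φ 0 = 0 := by
      by_contra h
      have := (D.hsupp 0 h).1
      norm_num at this
    simp [this]
  · calc _ ≤ ∑' j : ℤ, ENNReal.ofReal (D.Φ ((2 : ℝ) ^ (-j) • ξ)) := by
          gcongr with j
          rw [sq]
          exact mul_le_of_le_one_left' (ENNReal.ofReal_le_one.2 (D.h1 _))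
      _ = 1 := by
          rw [← ENNReal.ofReal_tsum_of_nonneg (fun _ => D.h0 _) (D.hsum ξ hξ).summable,
            (D.hsum ξ hξ).tsum_eq, ENNReal.ofReal_one]

/-- Almost orthogonality of the Littlewood-Paley pieces in `L²`. -/
lemma DyadicData.tsum_lTwo_sq_le (D : DyadicData) {b : E2 → ℝ≥0∞} (hb : Measurable b) :
    ∑' j : ℤ, lTwo volume (fun ξ => ENNReal.ofReal (D.Φ ((2 : ℝ) ^ (-j) • ξ)) * b ξ) ^ 2 ≤
      lTwo volume b ^ 2 := by
  have hΦ := D.continuous_Φ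
  simp only [lTwo_sq, mul_pow]
  rw [← lintegral_tsum]
  · refine lintegral_mono fun ξ => ?_
    rw [ENNReal.tsum_mul_right]
    exact mul_le_of_le_one_left' (D.tsum_sq_le_one ξ)
  · intro j
    have : Measurable fun ξ : E2 => D.Φ ((2 : ℝ) ^ (-j) • ξ) :=
      Continuous.measurable (by fun_prop)
    fun_prop

end

/-- the key bilinear estimate in `Ḃ^{−1/2}_{4,2}(ℝ²)` (endpoint
`(p,q) = (4,2)` of Lemma 3.1), restricted to Schwartz inputs. -/
theorem stmt18 (D : DyadicData) :
    ∃ C : ℝ≥0, 0 < C ∧ ∀ f g : SchwartzMap E2 ℂ,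
      (∑' j : ℤ, ((2 : ℝ≥0∞) ^ (-(j : ℝ) / 2) *
          eLpNorm (DeltaB D f g j) 4 volume) ^ (2 : ℕ)) ^ ((1 : ℝ) / 2) ≤
        (C : ℝ≥0∞) *
          (∑' j : ℤ, ((2 : ℝ≥0∞) ^ (-(j : ℝ) / 2) *
            eLpNorm (convPhi D j (fun x => f x)) 4 volume) ^ (2 : ℕ)) ^ ((1 : ℝ) / 2) *
          (∑' j : ℤ, ((2 : ℝ≥0∞) ^ (-(j : ℝ) / 2) *
            eLpNorm (convPhi D j (fun x => g x)) 4 volume) ^ (2 : ℕ)) ^ ((1 : ℝ) / 2) := by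
  obtain ⟨C₁, hC₁, h₁⟩ := exists_eLpNorm_DeltaB_le D
  obtain ⟨C₂, h₂⟩ := exists_eLpNorm_BHat_le_besovSum D
  refine ⟨C₁ * (C₂ + 1), by positivity, fun f g => ?_⟩
  have hpiece : ∀ (h : SchwartzMap E2 ℂ) (j : ℤ),
      convPhi D j (fun x => h x) = D.piece h j :=
    fun h j => funext fun x => (D.piece_apply h j x).symm
  simp only [hpiece]
  calc _ ≤ (∑' j : ℤ, (C₁ * lTwo volume (fun ξ => ENNReal.ofReal (D.Φ ((2 : ℝ) ^ (-j) • ξ)) *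
          ‖BHat f g ξ‖ₑ)) ^ 2) ^ ((1 : ℝ) / 2) := by
        exact ENNReal.rpow_le_rpow
          (ENNReal.tsum_le_tsum fun j => pow_le_pow_left' (h₁ f g j) 2) (by norm_num)
    _ ≤ (C₁ ^ 2 * eLpNorm (BHat f g) 2 volume ^ 2) ^ ((1 : ℝ) / 2) := by
        simp only [mul_pow]
        rw [ENNReal.tsum_mul_left, eLpNorm_two_eq_lTwo]
        gcongr
        exact D.tsum_lTwo_sq_le (measurable_BHat f g).enorm
    _ = C₁ * eLpNorm (BHat f g) 2 volume := by
        rw [← mul_pow, ENNReal.sq_rpow_half]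
    _ ≤ C₁ * ((C₂ + 1) * (besovSum (fun k => eLpNorm (D.piece f k) 4 volume) *
        besovSum (fun k => eLpNorm (D.piece g k) 4 volume))) := by
        gcongr
        refine (h₂ f g).trans ?_
        gcongr
        exact le_self_add
    _ = _ := by
        push_cast
        simp only [besovSum, mul_assoc]
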